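/- arXiv:1705.03284 — 7 statements merged into one kernel-verified Lean document; each statement's English description precedes it below -/
import Mathlib

section
/- If 2bn² · 2^(M + L + bt(n−1)) < 2^(nL), then there exists a function f : ({0,1}^L)^n → {0,1} that has no nondeterministic (n,b,M,L,t)-protocol. -/
/-- An `(n,b,L,t)`-protocol: each node `v` has a private input `x_v ∈ {0,1}^L`.
In each round `r` of the `t` rounds, node `v` sends a `b`-bit message to each
other node, computed from `x_v` and the messages `v` received in rounds before `r`;
after round `t`, node `v` outputs a bit computed from `x_v` and all messages it
received. -/
structure Protocol (n b L t : ℕ) where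
  msg : (v : Fin n) → (r : Fin t) → (Fin L → Bool) →
      ((r' : Fin t) → r' < r → {u : Fin n // u ≠ v} → Fin b → Bool) →
      {w : Fin n // w ≠ v} → Fin b → Bool
  out : (v : Fin n) → (Fin L → Bool) →
      (Fin t → {u : Fin n // u ≠ v} → Fin b → Bool) → Bool

/-- `P.recv x r v u` is the message that node `v` receives from node `u` in
round `r`, when the protocol `P` is executed on the input assignment `x`. -/
def Protocol.recv {n b L t : ℕ} (P : Protocol n b L t) (x : Fin n → Fin L → Bool)
    (r : Fin t) (v : Fin n) (u : {u : Fin n // u ≠ v}) : Fin b → Bool :=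
  P.msg u.1 r (x u.1) (fun r' hr' w => P.recv x r' u.1 w) ⟨v, Ne.symm u.2⟩
termination_by r.1
decreasing_by exact hr'

/-- The output bit of node `v` when `P` is executed on input assignment `x`. -/
def Protocol.output {n b L t : ℕ} (P : Protocol n b L t)
    (x : Fin n → Fin L → Bool) (v : Fin n) : Bool :=
  P.out v (x v) (fun r u => P.recv x r v u)

/-- `P` computes `f` if on every input every node outputs `f` of the input. -/
def Protocol.Computes {n b L t : ℕ} (P : Protocol n b L t)
    (f : (Fin n → Fin L → Bool) → Bool) : Prop :=
  ∀ x : Fin n → Fin L → Bool, ∀ v : Fin n, P.output x v = f x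

/-- `P` accepts the input assignment `x` if all nodes output `1`. -/
def Protocol.Accepts {n b L t : ℕ} (P : Protocol n b L t)
    (x : Fin n → Fin L → Bool) : Prop :=
  ∀ v : Fin n, P.output x v = true

/-- A nondeterministic `(n,b,M,L,t)`-protocol for `f` is an `(n,b,M+L,t)`-protocol
`P` such that for every input `x` we have `f x = 1` iff there are `M`-bit labels
`z_v` such that `P` accepts when each node `v` is given the concatenation `z_v x_v`. -/
def Protocol.IsNondetFor {n b L t M : ℕ} (P : Protocol n b (M + L) t)
    (f : (Fin n → Fin L → Bool) → Bool) : Prop :=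
  ∀ x : Fin n → Fin L → Bool,
    f x = true ↔
      ∃ z : Fin n → Fin M → Bool, P.Accepts (fun v => Fin.append (z v) (x v))

/-- A protocol is the same data as a family of message functions and output functions, with the
earlier rounds collected in a subtype. -/
def Protocol.equivPi (n b L t : ℕ) : Protocol n b L t ≃
    ((v : Fin n) → (((r : Fin t) → (Fin L → Bool) →
      ({r' : Fin t // r' < r} → {u : Fin n // u ≠ v} → Fin b → Bool) →
      {w : Fin n // w ≠ v} → Fin b → Bool) ×
      ((Fin L → Bool) → (Fin t → {u : Fin n // u ≠ v} → Fin b → Bool) → Bool))) where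
  toFun P v := (fun r y g => P.msg v r y fun r' hr' => g ⟨r', hr'⟩, P.out v)
  invFun F :=
    { msg := fun v r y g => (F v).1 r y fun s => g s.1 s.2
      out := fun v => (F v).2 }
  left_inv _ := rfl
  right_inv _ := rfl

set_option synthInstance.maxSize 1000 in
instance Protocol.instFinite (n b L t : ℕ) : Finite (Protocol n b L t) :=
  Finite.of_equiv _ (Protocol.equivPi n b L t).symm

set_option synthInstance.maxSize 1000 in
theorem Protocol.card_eq (n b L t : ℕ) : Nat.card (Protocol n b L t) =
    2 ^ (n * (∑ r : Fin t, b * (n - 1) * 2 ^ (L + b * (n - 1) * r.val) +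
      2 ^ (L + b * (n - 1) * t))) := by
  have card_ne (v : Fin n) : Fintype.card {u : Fin n // u ≠ v} = n - 1 := by simp
  have card_lt (r : Fin t) : Fintype.card {r' : Fin t // r' < r} = r.val := by
    rw [Fintype.card_subtype]
    simp [Finset.filter_gt_eq_Iio]
  rw [Nat.card_congr (Protocol.equivPi n b L t), Nat.card_eq_fintype_card]
  simp only [Fintype.card_pi, Fintype.card_prod, Finset.prod_const, Finset.card_univ,
    Fintype.card_fin, Fintype.card_bool, card_ne, card_lt, ← pow_mul, Finset.prod_pow_eq_pow_sum,
    ← pow_add]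
  congr 1
  rw [mul_comm]
  congr 2
  · refine Finset.sum_congr rfl fun r _ => ?_
    ring
  · ring

theorem mul_sum_two_pow_mul_le (k t : ℕ) :
    k * ∑ r : Fin t, 2 ^ (k * r.val) ≤ k * 2 ^ (k * t) := by
  rcases Nat.eq_zero_or_pos k with rfl | hk
  · simp
  refine Nat.mul_le_mul_left k ?_
  rw [Fin.sum_univ_eq_sum_range (fun r => 2 ^ (k * r)) t]
  simp only [pow_mul]
  exact (Nat.geomSum_lt (Nat.le_self_pow hk.ne' 2) fun _ => Finset.mem_range.mp).le

theorem Protocol.card_le (n b L t : ℕ) (hn : 0 < n) (hb : 0 < b) :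
    Nat.card (Protocol n b L t) ≤ 2 ^ (2 * b * n ^ 2 * 2 ^ (L + b * t * (n - 1))) := by
  rw [Protocol.card_eq]
  refine Nat.pow_le_pow_right two_pos ?_
  have hcoef : b * (n - 1) + 1 ≤ 2 * b * n := by
    obtain ⟨m, rfl⟩ := Nat.exists_eq_add_of_le' hn
    simp only [Nat.add_sub_cancel]
    nlinarith
  rw [show b * t * (n - 1) = b * (n - 1) * t by ring]
  set k := b * (n - 1)
  calc n * (∑ r : Fin t, k * 2 ^ (L + k * r.val) + 2 ^ (L + k * t))
      = n * 2 ^ L * (k * ∑ r : Fin t, 2 ^ (k * r.val) + 2 ^ (k * t)) := by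
        simp only [pow_add, ← Finset.mul_sum]
        ring
    _ ≤ n * 2 ^ L * (k * 2 ^ (k * t) + 2 ^ (k * t)) := by
        exact Nat.mul_le_mul_left _ (Nat.add_le_add_right (mul_sum_two_pow_mul_le k t) _)
    _ = n * (k + 1) * 2 ^ (L + k * t) := by ring
    _ ≤ n * (2 * b * n) * 2 ^ (L + k * t) := by gcongr
    _ = 2 * b * n ^ 2 * 2 ^ (L + k * t) := by ring

theorem Protocol.IsNondetFor.unique {n b L t M : ℕ} {P : Protocol n b (M + L) t}
    {f g : (Fin n → Fin L → Bool) → Bool} (hf : P.IsNondetFor f) (hg : P.IsNondetFor g) :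
    f = g :=
  funext fun x => Bool.eq_iff_iff.mpr ((hf x).trans (hg x).symm)

theorem exists_function_without_nondet_protocol (n b L t M : ℕ) (hn : 0 < n)
    (hb : 0 < b) (hL : 0 < L) (ht : 0 < t)
    (h : 2 * b * n ^ 2 * 2 ^ (M + L + b * t * (n - 1)) < 2 ^ (n * L)) :
    ∃ f : (Fin n → Fin L → Bool) → Bool,
      ∀ P : Protocol n b (M + L) t, ¬ P.IsNondetFor f := by
  by_contra! hall
  choose P hP using hall
  have hinj : Function.Injective P := fun f g hfg => (hP f).unique (hfg ▸ hP g)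
  have hle := (Nat.card_le_card_of_injective P hinj).trans
    (Protocol.card_le n b (M + L) t hn hb)
  have hcard : Nat.card ((Fin n → Fin L → Bool) → Bool) = 2 ^ 2 ^ (n * L) := by
    rw [Nat.card_eq_fintype_card]
    simp [← pow_mul, mul_comm]
  rw [hcard] at hle
  exact absurd hle (Nat.pow_lt_pow_right one_lt_two h).not_ge
end

section
/- If a function f : ({0,1}^L)^n → {0,1} has a nondeterministic (n,b,M,L,t)-protocol for some nonnegative integer M, then f has a nondeterministic (n,b,M',L,t)-protocol with label size M' = 2·t·b·(n−1), i.e., label size equal to the total number of bits sent and received by a single node during an execution. -/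
/-- The messages exchanged by node `v` with each other node over all the rounds. -/
abbrev Transcript (n b t : ℕ) (v : Fin n) : Type :=
  Fin t → {u : Fin n // u ≠ v} → Fin b → Bool

/-- If `s v` is the transcript of messages that node `v` claims to send, then it describes the
execution of `P` on `x` as soon as all nodes' claims are consistent with `P`. -/
theorem Protocol.recv_eq_of_consistent {n b L t : ℕ} (P : Protocol n b L t)
    (x : Fin n → Fin L → Bool) (s : (v : Fin n) → Transcript n b t v)
    (hs : ∀ v r, P.msg v r (x v) (fun r' _ u => s u.1 r' ⟨v, Ne.symm u.2⟩) = s v r)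
    (r : Fin t) (v : Fin n) (u : {u : Fin n // u ≠ v}) :
    P.recv x r v u = s u.1 r ⟨v, Ne.symm u.2⟩ := by
  induction r using WellFoundedLT.induction generalizing v u with
  | ind r ih =>
    rw [Protocol.recv, ← hs]
    congr 1
    funext r' hr' w
    exact ih r' hr' u.1 w

open Classical in
/-- The protocol in which the label of a node, read through `dec`, is the transcript of messages
it sends; a node accepts if some label of `P` makes `P` send this transcript and output `1`. -/
noncomputable def Protocol.guessTranscript {n b L t M : ℕ} (P : Protocol n b (M + L) t) (K : ℕ)
    (dec : (v : Fin n) → (Fin K → Bool) → Transcript n b t v) : Protocol n b (K + L) t where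
  msg v r y _ := dec v (fun i => y (Fin.castAdd L i)) r
  out v y m := decide (∃ z : Fin M → Bool,
    (∀ r, P.msg v r (Fin.append z (fun i => y (Fin.natAdd K i))) (fun r' _ => m r') =
      dec v (fun i => y (Fin.castAdd L i)) r) ∧
    P.out v (Fin.append z (fun i => y (Fin.natAdd K i))) m = true)

theorem Protocol.guessTranscript_accepts_iff {n b L t M K : ℕ} (P : Protocol n b (M + L) t)
    (dec : (v : Fin n) → (Fin K → Bool) → Transcript n b t v)
    (x : Fin n → Fin L → Bool) (y : Fin n → Fin K → Bool) :
    (P.guessTranscript K dec).Accepts (fun v => Fin.append (y v) (x v)) ↔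
      ∀ v, ∃ z : Fin M → Bool,
        (∀ r, P.msg v r (Fin.append z (x v))
          (fun r' _ u => dec u.1 (y u.1) r' ⟨v, Ne.symm u.2⟩) = dec v (y v) r) ∧
        P.out v (Fin.append z (x v)) (fun r u => dec u.1 (y u.1) r ⟨v, Ne.symm u.2⟩) = true := by
  have hrecv : ∀ r v u, (P.guessTranscript K dec).recv (fun v => Fin.append (y v) (x v)) r v u =
      dec u.1 (y u.1) r ⟨v, Ne.symm u.2⟩ := by
    intro r v u
    rw [Protocol.recv]
    simp [Protocol.guessTranscript]
  simp only [Protocol.Accepts, Protocol.output, hrecv]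
  simp [Protocol.guessTranscript]

theorem Protocol.IsNondetFor.guessTranscript {n b L t M K : ℕ} {P : Protocol n b (M + L) t}
    {f : (Fin n → Fin L → Bool) → Bool} (hP : P.IsNondetFor f)
    (dec : (v : Fin n) → (Fin K → Bool) → Transcript n b t v)
    (hdec : ∀ v, Function.Surjective (dec v)) :
    (P.guessTranscript K dec).IsNondetFor f := by
  intro x
  rw [hP x]
  simp only [Protocol.guessTranscript_accepts_iff]
  constructor
  · rintro ⟨z, hz⟩
    choose y hy using fun v => hdec v (fun r w =>
      P.recv (fun v => Fin.append (z v) (x v)) r w.1 ⟨v, Ne.symm w.2⟩)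
    refine ⟨y, fun v => ⟨z v, fun r => ?_, ?_⟩⟩
    · simp only [hy]
      funext w
      rw [Protocol.recv]
    · simp only [hy]
      exact hz v
  · rintro ⟨y, hy⟩
    choose z hmsg hout using hy
    refine ⟨z, fun v => ?_⟩
    have hrecv := P.recv_eq_of_consistent (fun v => Fin.append (z v) (x v))
      (fun v => dec v (y v)) hmsg
    simp only [Protocol.output, hrecv]
    exact hout v

theorem exists_surjective_transcript {n b t K : ℕ} (v : Fin n) (hK : t * ((n - 1) * b) ≤ K) :
    ∃ dec : (Fin K → Bool) → Transcript n b t v, Function.Surjective dec := by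
  have hcard : Fintype.card (Fin t × {u : Fin n // u ≠ v} × Fin b) ≤ Fintype.card (Fin K) := by
    simpa [Fintype.card_subtype_compl] using hK
  obtain ⟨ι⟩ := Function.Embedding.nonempty_of_card_le hcard
  refine ⟨fun y r u i => y (ι (r, u, i)), fun s => ?_⟩
  obtain ⟨y, hy⟩ := ι.injective.surjective_comp_right (fun p => s p.1 p.2.1 p.2.2)
  exact ⟨y, funext fun r => funext fun u => funext fun i => congrFun hy (r, u, i)⟩

theorem nondet_protocol_normal_form (n b L t : ℕ) (hn : 0 < n) (hb : 0 < b)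
    (hL : 0 < L) (ht : 0 < t) (f : (Fin n → Fin L → Bool) → Bool)
    (h : ∃ (M : ℕ) (P : Protocol n b (M + L) t), P.IsNondetFor f) :
    ∃ P' : Protocol n b (2 * t * b * (n - 1) + L) t, P'.IsNondetFor f := by
  obtain ⟨M, P, hP⟩ := h
  have hK : t * ((n - 1) * b) ≤ 2 * t * b * (n - 1) := by
    calc t * ((n - 1) * b) ≤ 2 * (t * ((n - 1) * b)) := Nat.le_mul_of_pos_left _ two_pos
      _ = 2 * t * b * (n - 1) := by ring
  choose dec hdec using fun v : Fin n => exists_surjective_transcript v hK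
  exact ⟨_, hP.guessTranscript dec hdec⟩
end

section
/- Let n ≥ 2, L ≥ 1, and let the bandwidth satisfy b ≥ ⌈log₂(nL)⌉ + 1. Then every function f : ({0,1}^L)^n → {0,1} is Σ₂-computed by some 2-alternation protocol with t = 1 round, existential label size M₁ = nL, and universal label size M₂ = ⌈log₂(nL)⌉. -/
/-- A 2-alternation protocol with existential label size `M₁` and universal label
size `M₂` is an `(n,b,M₁+M₂+L,t)`-protocol, where node `v` receives the
concatenation of its two labels and its input.  It `Σ₂`-computes `f` if for
every input `x` we have `f x = 1` iff
`∃ z₁ ∀ z₂ : P(x, z₁, z₂) = 1`, where `z₁` (resp. `z₂`) ranges over assignments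
of `M₁`-bit (resp. `M₂`-bit) labels to the nodes. -/
def Protocol.Sigma2Computes {n b L t M₁ M₂ : ℕ} (P : Protocol n b (M₁ + (M₂ + L)) t)
    (f : (Fin n → Fin L → Bool) → Bool) : Prop :=
  ∀ x : Fin n → Fin L → Bool,
    f x = true ↔
      ∃ z₁ : Fin n → Fin M₁ → Bool, ∀ z₂ : Fin n → Fin M₂ → Bool,
        P.Accepts (fun v => Fin.append (z₁ v) (Fin.append (z₂ v) (x v)))

/-- The guess-and-compare protocol: the first label of a node is a guess `g` of the whole input,
the second one names, through `idx`, a position `i` in that guess, and the node broadcasts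
`enc (i, g i)`. A node accepts if its guess agrees with its own input, is mapped to `true` by `f`,
and is consistent with every received bit. -/
noncomputable def guessAndCompare {n b c L : ℕ} (f : (Fin n → Fin L → Bool) → Bool)
    (idx : (Fin c → Bool) → Fin (n * L)) (enc : Fin (n * L) × Bool → Fin b → Bool) :
    Protocol n b (n * L + (c + L)) 1 where
  msg := fun _ _ y _ _ =>
    let i := idx fun j => y (Fin.natAdd _ (Fin.castAdd _ j))
    enc (i, y (Fin.castAdd _ i))
  out := fun v y received =>
    open Classical in
    decide ((∀ j, y (Fin.natAdd _ (Fin.natAdd _ j)) = y (Fin.castAdd _ (finProdFinEquiv (v, j)))) ∧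
      f (fun u j => y (Fin.castAdd _ (finProdFinEquiv (u, j)))) = true ∧
      ∀ u i a, received 0 u = enc (i, a) → y (Fin.castAdd _ i) = a)

theorem guessAndCompare_output {n b c L : ℕ} (f : (Fin n → Fin L → Bool) → Bool)
    (idx : (Fin c → Bool) → Fin (n * L)) {enc : Fin (n * L) × Bool → Fin b → Bool}
    (henc : Function.Injective enc) (x : Fin n → Fin L → Bool) (z₁ : Fin n → Fin (n * L) → Bool)
    (z₂ : Fin n → Fin c → Bool) (v : Fin n) :
    (guessAndCompare f idx enc).output
        (fun v => Fin.append (z₁ v) (Fin.append (z₂ v) (x v))) v = true ↔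
      (∀ j, x v j = z₁ v (finProdFinEquiv (v, j))) ∧
      f (fun u j => z₁ v (finProdFinEquiv (u, j))) = true ∧
      ∀ u, u ≠ v → z₁ v (idx (z₂ u)) = z₁ u (idx (z₂ u)) := by
  unfold Protocol.output
  simp only [Protocol.recv, guessAndCompare, decide_eq_true_eq, Fin.append_left, Fin.append_right,
    henc.eq_iff, Prod.mk.injEq]
  refine and_congr_right' (and_congr_right' ⟨fun h u hu => h ⟨u, hu⟩ _ _ ⟨rfl, rfl⟩, ?_⟩)
  rintro h u _ _ ⟨rfl, rfl⟩
  exact h u.1 u.2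

theorem guessAndCompare_sigma2Computes {n b c L : ℕ} (f : (Fin n → Fin L → Bool) → Bool)
    (hn : 0 < n) {idx : (Fin c → Bool) → Fin (n * L)} (hidx : Function.Surjective idx)
    {enc : Fin (n * L) × Bool → Fin b → Bool} (henc : Function.Injective enc) :
    (guessAndCompare f idx enc).Sigma2Computes f := by
  intro x
  simp only [Protocol.Accepts, guessAndCompare_output f idx henc]
  constructor
  · intro hx
    refine ⟨fun _ i => x (finProdFinEquiv.symm i).1 (finProdFinEquiv.symm i).2, ?_⟩
    simp [hx]
  · rintro ⟨z₁, h⟩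
    have agree : ∀ u v, z₁ v = z₁ u := by
      intro u v
      rcases eq_or_ne u v with rfl | huv
      · rfl
      · funext i
        obtain ⟨w, rfl⟩ := hidx i
        exact (h (fun _ => w) v).2.2 u huv
    let v₀ : Fin n := ⟨0, hn⟩
    have hx : (fun u j => z₁ v₀ (finProdFinEquiv (u, j))) = x := by
      funext u j
      rw [agree u v₀]
      obtain ⟨w, -⟩ := hidx (finProdFinEquiv (u, j))
      exact ((h (fun _ => w) u).1 j).symm
    rw [← hx]
    exact (h (fun _ _ => false) v₀).2.1

theorem every_function_sigma2_computable (n b L : ℕ) (hn : 2 ≤ n) (hL : 1 ≤ L)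
    (hb : Nat.clog 2 (n * L) + 1 ≤ b) (f : (Fin n → Fin L → Bool) → Bool) :
    ∃ P : Protocol n b (n * L + (Nat.clog 2 (n * L) + L)) 1,
      P.Sigma2Computes f := by
  have hclog : n * L ≤ 2 ^ Nat.clog 2 (n * L) := Nat.le_pow_clog one_lt_two _
  have : Nonempty (Fin (n * L)) := ⟨⟨0, Nat.mul_pos (by lia) hL⟩⟩
  obtain ⟨e⟩ : Nonempty (Fin (n * L) ↪ (Fin (Nat.clog 2 (n * L)) → Bool)) :=
    Function.Embedding.nonempty_of_card_le (by simpa using hclog)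
  obtain ⟨enc⟩ : Nonempty (Fin (n * L) × Bool ↪ (Fin b → Bool)) := by
    refine Function.Embedding.nonempty_of_card_le ?_
    simp only [Fintype.card_prod, Fintype.card_fin, Fintype.card_bool, Fintype.card_pi,
      Finset.prod_const, Finset.card_univ]
    calc n * L * 2 ≤ 2 ^ Nat.clog 2 (n * L) * 2 := Nat.mul_le_mul_right 2 hclog
      _ = 2 ^ (Nat.clog 2 (n * L) + 1) := (pow_succ _ _).symm
      _ ≤ 2 ^ b := Nat.pow_le_pow_right two_pos hb
  exact ⟨guessAndCompare f (Function.invFun e) enc, guessAndCompare_sigma2Computes f (by lia)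
    (Function.invFun_surjective e.injective) enc.injective⟩
end

section
/- Let G = (V,E) be a graph with |V| = n and let k be an integer with 1 ≤ k ≤ n. Then the graph G' has at most (k² + k + 2)n vertices, and G has an independent set of size k if and only if G' has a dominating set of size k. -/
/-- The vertex set of the graph `G'`: for each `i ∈ {1,…,k}` a copy `K^i` of `V`
(the left summand, `v^i = Sum.inl (i, v)`), for each pair `i < j` a copy
`I^{i,j}` of `V` (the middle summand, `v^{i,j} = Sum.inr (Sum.inl (⟨(i,j),_⟩, v))`),
and for each `i` two special vertices `x^i, y^i` (the right summand,
`x^i = Sum.inr (Sum.inr (i, false))`, `y^i = Sum.inr (Sum.inr (i, true))`). -/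
abbrev GPrimeVertex (V : Type) (k : ℕ) : Type :=
  (Fin k × V) ⊕ (({p : Fin k × Fin k // p.1 < p.2}) × V) ⊕ (Fin k × Bool)

/-- The generating relation for the edges of `G'`: each `K^i` is a clique;
`v^i ∈ K^i` is joined to `u^{i,j} ∈ I^{i,j}` for every `u ≠ v`, and `v^j ∈ K^j`
is joined to `u^{i,j} ∈ I^{i,j}` for every `u ≠ v` with `{u,v} ∉ E`; and the
special vertices `x^i, y^i` are joined to every vertex of `K^i`. -/
def GPrimeRel {V : Type} (G : SimpleGraph V) (k : ℕ) :
    GPrimeVertex V k → GPrimeVertex V k → Prop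
  | Sum.inl (i, _), Sum.inl (i', _) => i = i'
  | Sum.inl (i, v), Sum.inr (Sum.inl (⟨⟨i₁, i₂⟩, _⟩, u)) =>
      (i = i₁ ∧ u ≠ v) ∨ (i = i₂ ∧ u ≠ v ∧ ¬ G.Adj u v)
  | Sum.inl (i, _), Sum.inr (Sum.inr (i', _)) => i = i'
  | _, _ => False

/-- The graph `G'` built from `G` and `k`. -/
def GPrime {V : Type} (G : SimpleGraph V) (k : ℕ) : SimpleGraph (GPrimeVertex V k) :=
  SimpleGraph.fromRel (GPrimeRel G k)

/-- `I` is an independent set of `H`: no two of its vertices are adjacent. -/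
def IsIndepSetOf {W : Type*} (H : SimpleGraph W) (I : Finset W) : Prop :=
  ∀ u ∈ I, ∀ v ∈ I, u ≠ v → ¬ H.Adj u v

/-- `D` is a dominating set of `H`: every vertex is in `D` or adjacent to a
vertex of `D`. -/
def IsDomSetOf {W : Type*} (H : SimpleGraph W) (D : Finset W) : Prop :=
  ∀ w : W, w ∈ D ∨ ∃ d ∈ D, H.Adj d w

namespace GPrime

variable {V : Type} {G : SimpleGraph V} {k : ℕ}

theorem adj_clique_clique {i j : Fin k} {u v : V} :
    (GPrime G k).Adj (Sum.inl (i, u)) (Sum.inl (j, v)) ↔ i = j ∧ u ≠ v := by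
  simp only [GPrime, SimpleGraph.fromRel_adj, GPrimeRel, ne_eq, Sum.inl.injEq, Prod.mk.injEq]
  grind

theorem adj_clique_special {i j : Fin k} {v : V} {b : Bool} :
    (GPrime G k).Adj (Sum.inl (i, v)) (Sum.inr (Sum.inr (j, b))) ↔ i = j := by
  simp [GPrime, GPrimeRel]

theorem adj_clique_pair {i j l : Fin k} (hjl : j < l) {u v : V} :
    (GPrime G k).Adj (Sum.inl (i, v)) (Sum.inr (Sum.inl (⟨(j, l), hjl⟩, u))) ↔
      (i = j ∧ u ≠ v) ∨ (i = l ∧ u ≠ v ∧ ¬ G.Adj u v) := by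
  simp [GPrime, GPrimeRel]

theorem not_adj_inr_inr (a b : ({p : Fin k × Fin k // p.1 < p.2} × V) ⊕ (Fin k × Bool)) :
    ¬ (GPrime G k).Adj (Sum.inr a) (Sum.inr b) := by
  simp [GPrime, GPrimeRel]

theorem card_vertex_le [Fintype V] (hkn : k ≤ Fintype.card V) :
    Fintype.card (GPrimeVertex V k) ≤ (k ^ 2 + k + 2) * Fintype.card V := by
  have h : Fintype.card {p : Fin k × Fin k // p.1 < p.2} ≤ k * k := by
    simpa using Fintype.card_subtype_le fun p : Fin k × Fin k => p.1 < p.2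
  simp only [GPrimeVertex, Fintype.card_sum, Fintype.card_prod, Fintype.card_fin,
    Fintype.card_bool]
  nlinarith [Nat.mul_le_mul_right (Fintype.card V) h]

/-- Choosing one vertex in each clique, injectively and independently, dominates `G'`. -/
theorem isDomSetOf_image [DecidableEq V] {g : Fin k → V}
    (hinj : Function.Injective g) (hind : ∀ i j, ¬ G.Adj (g i) (g j)) :
    IsDomSetOf (GPrime G k) (Finset.univ.image fun i => Sum.inl (i, g i)) := by
  have hmem (i : Fin k) : (Sum.inl (i, g i) : GPrimeVertex V k) ∈
      Finset.univ.image fun i => (Sum.inl (i, g i) : GPrimeVertex V k) :=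
    Finset.mem_image_of_mem _ (Finset.mem_univ i)
  rintro (⟨i, v⟩ | ⟨⟨⟨i, j⟩, hij⟩, u⟩ | ⟨i, b⟩)
  · by_cases hv : g i = v
    · exact Or.inl (hv ▸ hmem i)
    · exact Or.inr ⟨_, hmem i, adj_clique_clique.2 ⟨rfl, hv⟩⟩
  · by_cases hu : u = g i
    · subst hu
      exact Or.inr ⟨_, hmem j, (adj_clique_pair hij).2
        (Or.inr ⟨rfl, hinj.ne (ne_of_lt hij), hind i j⟩)⟩
    · exact Or.inr ⟨_, hmem i, (adj_clique_pair hij).2 (Or.inl ⟨rfl, hu⟩)⟩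
  · exact Or.inr ⟨_, hmem i, adj_clique_special.2 rfl⟩

/-- A dominating set meets `K^i ∪ {x^i, y^i}`, because it dominates `x^i` and `y^i`. -/
theorem exists_mem_of_isDomSetOf {D : Finset (GPrimeVertex V k)}
    (hD : IsDomSetOf (GPrime G k) D) (i : Fin k) (b : Bool) :
    Sum.inr (Sum.inr (i, b)) ∈ D ∨ ∃ v, Sum.inl (i, v) ∈ D := by
  obtain h | ⟨⟨j, v⟩ | a, hd, hadj⟩ := hD (Sum.inr (Sum.inr (i, b)))
  · exact Or.inl h
  · obtain rfl := adj_clique_special.1 hadj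
    exact Or.inr ⟨v, hd⟩
  · exact absurd hadj (not_adj_inr_inr _ _)

/-- A dominating set of size `k` consists of exactly one vertex of each clique `K^i`. -/
theorem exists_eq_image_of_isDomSetOf [DecidableEq V] {D : Finset (GPrimeVertex V k)}
    (hcard : D.card = k) (hD : IsDomSetOf (GPrime G k) D) :
    ∃ g : Fin k → V, D = Finset.univ.image fun i => Sum.inl (i, g i) := by
  have hsel (i : Fin k) : ∃ d ∈ D, d = Sum.inr (Sum.inr (i, false)) ∨ ∃ v, d = Sum.inl (i, v) := by
    obtain h | ⟨v, h⟩ := exists_mem_of_isDomSetOf hD i false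
    · exact ⟨_, h, Or.inl rfl⟩
    · exact ⟨_, h, Or.inr ⟨v, rfl⟩⟩
  choose f hfD hf using hsel
  have hinj : Function.Injective f := by
    intro i j hij
    have hi := hf i
    have hj := hf j
    grind
  have himage : Finset.univ.image f = D := by
    refine Finset.eq_of_subset_of_card_le (by simpa [Finset.subset_iff] using hfD) ?_
    rw [Finset.card_image_of_injective _ hinj, hcard, Finset.card_univ, Fintype.card_fin]
  have hclique (i : Fin k) : ∃ v, f i = Sum.inl (i, v) := by
    have hrange {d} (hd : d ∈ D) : ∃ j, f j = d := by simpa [← himage] using hd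
    obtain h | ⟨v, h⟩ := exists_mem_of_isDomSetOf hD i true
    all_goals
      obtain ⟨j, hj⟩ := hrange h
      have := hf j
      grind
  choose g hg using hclique
  exact ⟨g, by simp only [← himage, ← hg]⟩

theorem ne_and_not_adj_of_isDomSetOf_image [DecidableEq V] {g : Fin k → V}
    (hD : IsDomSetOf (GPrime G k) (Finset.univ.image fun i => Sum.inl (i, g i)))
    {i j : Fin k} (hij : i < j) : g i ≠ g j ∧ ¬ G.Adj (g i) (g j) := by
  obtain h | ⟨d, hd, hadj⟩ := hD (Sum.inr (Sum.inl (⟨(i, j), hij⟩, g i)))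
  · simp at h
  · obtain ⟨l, -, rfl⟩ := Finset.mem_image.1 hd
    obtain ⟨rfl, h⟩ | ⟨rfl, h⟩ := (adj_clique_pair hij).1 hadj
    · exact absurd rfl h
    · exact h

end GPrime

theorem gprime_card_and_indep_iff_dom {V : Type} [Fintype V] [DecidableEq V]
    (G : SimpleGraph V) (k : ℕ) (hk1 : 1 ≤ k) (hkn : k ≤ Fintype.card V) :
    Fintype.card (GPrimeVertex V k) ≤ (k ^ 2 + k + 2) * Fintype.card V ∧
    ((∃ I : Finset V, I.card = k ∧ IsIndepSetOf G I) ↔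
      ∃ D : Finset (GPrimeVertex V k), D.card = k ∧ IsDomSetOf (GPrime G k) D) := by
  refine ⟨GPrime.card_vertex_le hkn, ?_, ?_⟩
  · rintro ⟨I, hcard, hI⟩
    let e := I.equivFinOfCardEq hcard
    have hinj : Function.Injective fun i => (e.symm i : V) :=
      Subtype.val_injective.comp e.symm.injective
    refine ⟨_, ?_, GPrime.isDomSetOf_image (G := G) hinj fun i j hadj =>
      hI _ (e.symm i).2 _ (e.symm j).2 hadj.ne hadj⟩
    rw [Finset.card_image_of_injective _ fun i j h =>
      (Prod.mk.inj (Sum.inl_injective h)).1, Finset.card_univ, Fintype.card_fin]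
  · rintro ⟨D, hcard, hD⟩
    obtain ⟨g, rfl⟩ := GPrime.exists_eq_image_of_isDomSetOf hcard hD
    have hinj : Function.Injective g := fun i j h => by
      by_contra hne
      obtain hlt | hlt := lt_or_gt_of_ne hne
      · exact (GPrime.ne_and_not_adj_of_isDomSetOf_image hD hlt).1 h
      · exact (GPrime.ne_and_not_adj_of_isDomSetOf_image hD hlt).1 h.symm
    refine ⟨Finset.univ.image g, ?_, ?_⟩
    · rw [Finset.card_image_of_injective _ hinj, Finset.card_univ, Fintype.card_fin]
    · intro u hu v hv huv hadj
      obtain ⟨i, -, rfl⟩ := Finset.mem_image.1 hu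
      obtain ⟨j, -, rfl⟩ := Finset.mem_image.1 hv
      obtain hlt | hlt := lt_or_gt_of_ne (ne_of_apply_ne g huv)
      · exact (GPrime.ne_and_not_adj_of_isDomSetOf_image hD hlt).2 hadj
      · exact (GPrime.ne_and_not_adj_of_isDomSetOf_image hD hlt).2 hadj.symm
end

section
/- Let G = (V,E) be a graph with |V| = n and let k be an integer with 1 ≤ k ≤ n. If D is a dominating set of G' with |D| ≤ k, then for every i ∈ {1,…,k} the set D contains exactly one vertex of K^i; in particular, D is contained in K¹ ∪ ⋯ ∪ K^k and contains no vertex of any I^{i,j} and no special vertex. -/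
/-- The index `i` of the block `K^i ∪ {x^i, y^i}` containing a vertex of `G'`, if any. -/
def GPrimeVertex.block {V : Type} {k : ℕ} : GPrimeVertex V k → Option (Fin k)
  | Sum.inl (i, _) => some i
  | Sum.inr (Sum.inl _) => none
  | Sum.inr (Sum.inr (i, _)) => some i

/-- A dominating set of `G'` that misses a special vertex of index `i` meets `K^i`. -/
theorem IsDomSetOf.special_mem_or_exists_mem {V : Type} {G : SimpleGraph V} {k : ℕ}
    {D : Finset (GPrimeVertex V k)} (hdom : IsDomSetOf (GPrime G k) D) (i : Fin k) (b : Bool) :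
    Sum.inr (Sum.inr (i, b)) ∈ D ∨ ∃ v : V, Sum.inl (i, v) ∈ D := by
  refine (hdom (Sum.inr (Sum.inr (i, b)))).imp_right ?_
  rintro ⟨d, hd, hadj⟩
  rcases d with ⟨j, v⟩ | ⟨p, v⟩ | ⟨j, c⟩ <;>
    simp only [GPrime, SimpleGraph.fromRel_adj, GPrimeRel, or_false, or_self, and_false] at hadj
  obtain ⟨-, rfl⟩ := hadj
  exact ⟨v, hd⟩

theorem IsDomSetOf.exists_mem_block_eq {V : Type} {G : SimpleGraph V} {k : ℕ}
    {D : Finset (GPrimeVertex V k)} (hdom : IsDomSetOf (GPrime G k) D) (i : Fin k) :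
    ∃ w ∈ D, GPrimeVertex.block w = some i := by
  rcases hdom.special_mem_or_exists_mem i false with h | ⟨v, h⟩
  exacts [⟨_, h, rfl⟩, ⟨_, h, rfl⟩]

/-- Every vertex of a dominating set of `G'` of size at most `k` lies in some block, and no two
of them lie in the same block. -/
theorem IsDomSetOf.exists_block_eq_and_injOn_block {V : Type} {G : SimpleGraph V} {k : ℕ}
    {D : Finset (GPrimeVertex V k)} (hdom : IsDomSetOf (GPrime G k) D) (hcard : D.card ≤ k) :
    (∀ w ∈ D, ∃ i, GPrimeVertex.block w = some i) ∧
      Set.InjOn (GPrimeVertex.block (V := V) (k := k)) D := by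
  classical
  choose f hfD hf using hdom.exists_mem_block_eq
  have hinj : Function.Injective f := fun i j hij =>
    Option.some_injective _ (by rw [← hf i, ← hf j, hij])
  have himage : Finset.univ.image f = D := by
    apply Finset.eq_of_subset_of_card_le
    · simpa [Finset.subset_iff] using hfD
    · simpa [Finset.card_image_of_injective _ hinj] using hcard
  have hmem : ∀ w ∈ D, ∃ i, f i = w := fun w hw => by simpa [← himage] using hw
  refine ⟨fun w hw => ?_, fun w hw w' hw' h => ?_⟩
  · obtain ⟨i, rfl⟩ := hmem w hw
    exact ⟨i, hf i⟩
  · obtain ⟨i, rfl⟩ := hmem w hw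
    obtain ⟨j, rfl⟩ := hmem w' hw'
    rw [Option.some_injective _ ((hf i).symm.trans (h.trans (hf j)))]

theorem gprime_dom_set_structure {V : Type} [Fintype V] [DecidableEq V]
    (G : SimpleGraph V) (k : ℕ) (hk1 : 1 ≤ k) (hkn : k ≤ Fintype.card V)
    (D : Finset (GPrimeVertex V k)) (hdom : IsDomSetOf (GPrime G k) D)
    (hcard : D.card ≤ k) :
    (∀ i : Fin k, ∃! v : V, Sum.inl (i, v) ∈ D) ∧
    (∀ w ∈ D, ∃ (i : Fin k) (v : V), w = Sum.inl (i, v)) := by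
  obtain ⟨hblock, hinj⟩ := hdom.exists_block_eq_and_injOn_block hcard
  have hex : ∀ i : Fin k, ∃ v : V, Sum.inl (i, v) ∈ D := by
    intro i
    rcases hdom.special_mem_or_exists_mem i false with hx | h
    · rcases hdom.special_mem_or_exists_mem i true with hy | h
      · simpa using hinj hx hy rfl
      · exact h
    · exact h
  refine ⟨fun i => ?_, fun w hw => ?_⟩
  · obtain ⟨v, hv⟩ := hex i
    exact ⟨v, hv, fun u hu => by simpa using hinj hu hv rfl⟩
  · obtain ⟨i, hi⟩ := hblock w hw
    obtain ⟨v, hv⟩ := hex i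
    exact ⟨i, v, hinj hw hv hi⟩
end

section
/- Let G = (V,E) be a graph with |V| = n, let k ≥ 2, let i < j be indices in {1,…,k}, and let u, v ∈ V. Then every vertex of I^{i,j} is adjacent in G' to u^i ∈ K^i or to v^j ∈ K^j if and only if u ≠ v and {u,v} ∉ E. -/
theorem GPrime_adj_left {V : Type} (G : SimpleGraph V) {k : ℕ} {i j : Fin k} (hij : i < j)
    (v w : V) :
    (GPrime G k).Adj (Sum.inl (i, v)) (Sum.inr (Sum.inl (⟨(i, j), hij⟩, w))) ↔ w ≠ v := by
  simp [GPrime, GPrimeRel, hij.ne]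

theorem GPrime_adj_right {V : Type} (G : SimpleGraph V) {k : ℕ} {i j : Fin k} (hij : i < j)
    (v w : V) :
    (GPrime G k).Adj (Sum.inl (j, v)) (Sum.inr (Sum.inl (⟨(i, j), hij⟩, w))) ↔
      w ≠ v ∧ ¬ G.Adj w v := by
  simp [GPrime, GPrimeRel, hij.ne']

theorem gprime_compatibility_gadget {V : Type} [Fintype V] [DecidableEq V]
    (G : SimpleGraph V) (k : ℕ) (hk : 2 ≤ k) (i j : Fin k) (hij : i < j)
    (u v : V) :
    (∀ w : V,
        (GPrime G k).Adj (Sum.inl (i, u)) (Sum.inr (Sum.inl (⟨(i, j), hij⟩, w))) ∨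
        (GPrime G k).Adj (Sum.inl (j, v)) (Sum.inr (Sum.inl (⟨(i, j), hij⟩, w)))) ↔
      (u ≠ v ∧ ¬ G.Adj u v) := by
  simp only [GPrime_adj_left, GPrime_adj_right]
  refine ⟨fun h => (h u).resolve_left (fun hu => hu rfl), fun h w => ?_⟩
  rcases eq_or_ne w u with rfl | hw
  · exact Or.inr h
  · exact Or.inl hw
end

section
/- Let G = (V,E) be a graph, k a natural number, and let C = {v ∈ V : deg_G(v) ≥ k+1} be the set of vertices of degree at least k+1. If |C| ≤ k, then G has a vertex cover of size at most k if and only if the induced subgraph G[V ∖ C] has a vertex cover of size at most k − |C|. -/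
/-- `C` is a vertex cover of `H`: every edge has at least one endpoint in `C`. -/
def IsVertexCoverOf {W : Type*} (H : SimpleGraph W) (C : Finset W) : Prop :=
  ∀ u v : W, H.Adj u v → u ∈ C ∨ v ∈ C

theorem IsVertexCoverOf.mem_of_card_lt_degree {V : Type*} [Fintype V] {G : SimpleGraph V}
    [DecidableRel G.Adj] {C : Finset V} (hC : IsVertexCoverOf G C) {v : V}
    (hv : C.card < G.degree v) : v ∈ C := by
  by_contra hvC
  have hsub : G.neighborFinset v ⊆ C := fun w hw =>
    (hC v w ((G.mem_neighborFinset v w).1 hw)).resolve_left hvC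
  exact hv.not_ge (G.card_neighborFinset_eq_degree v ▸ Finset.card_le_card hsub)

theorem vertex_cover_kernelisation {V : Type} [Fintype V] [DecidableEq V]
    (G : SimpleGraph V) [DecidableRel G.Adj] (k : ℕ) (C : Finset V)
    (hCdef : C = Finset.univ.filter fun v => k + 1 ≤ G.degree v)
    (hCk : C.card ≤ k) :
    (∃ C' : Finset V, C'.card ≤ k ∧ IsVertexCoverOf G C') ↔
    (∃ D : Finset ((↑C : Set V)ᶜ : Set V), D.card ≤ k - C.card ∧
      IsVertexCoverOf (G.induce ((↑C : Set V)ᶜ)) D) := by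
  constructor
  · rintro ⟨C', hcard, hcover⟩
    have hsub : C ⊆ C' := fun v hv => by
      rw [hCdef, Finset.mem_filter] at hv
      exact hcover.mem_of_card_lt_degree (by omega)
    refine ⟨Finset.univ.filter fun x => (x : V) ∈ C', ?_, fun u v huv => ?_⟩
    · have hle : (Finset.univ.filter fun x : ((↑C : Set V)ᶜ : Set V) => (x : V) ∈ C').card ≤
          (C' \ C).card := by
        refine Finset.card_le_card_of_injOn Subtype.val (fun x hx => ?_)
          Subtype.val_injective.injOn
        have hxC := x.2
        simp_all
      rw [Finset.card_sdiff_of_subset hsub] at hle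
      omega
    · simpa using hcover u v huv
  · rintro ⟨D, hcard, hcover⟩
    refine ⟨C ∪ D.map (Function.Embedding.subtype _), ?_, fun u v huv => ?_⟩
    · have hle := Finset.card_union_le C (D.map (Function.Embedding.subtype _))
      rw [Finset.card_map] at hle
      omega
    · by_cases hu : u ∈ C
      · simp [hu]
      by_cases hv : v ∈ C
      · simp [hv]
      have h := hcover ⟨u, by simpa using hu⟩ ⟨v, by simpa using hv⟩ huv
      simpa [hu, hv] using h
end
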